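/- For all real s with 0 < s < 1, we have ζ(s) - ψ(1-s) < (γ - 1/2) + (γ + 1/2)·s, where γ is the Euler–Mascheroni constant. -/

import Mathlib

/-- The real digamma function `ψ = Γ'/Γ`. -/
noncomputable def digammaReal (x : ℝ) : ℝ := deriv Real.Gamma x / Real.Gamma x

open Filter Topology Set

/-- One-sided error bound for the trapezoidal rule on an interval of length one, in terms of an
upper bound for the second derivative. -/
lemma trapezoid_error_le {H h h' h'' : ℝ → ℝ} {a C : ℝ}
    (hH : ∀ x ∈ Icc a (a + 1), HasDerivAt H (h x) x)
    (hh : ∀ x ∈ Icc a (a + 1), HasDerivAt h (h' x) x)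
    (hh' : ∀ x ∈ Icc a (a + 1), HasDerivAt h' (h'' x) x)
    (hC : ∀ x ∈ Icc a (a + 1), h'' x ≤ C) :
    (h a + h (a + 1)) / 2 - (H (a + 1) - H a) ≤ C / 12 := by
  have ha : a ∈ Icc a (a + 1) := by simp
  have hb : a + 1 ∈ Icc a (a + 1) := by simp
  let P : ℝ → ℝ := fun x ↦ (x - a) * (h a + h x) / 2 - (H x - H a) - C * (x - a) ^ 3 / 12
  let Q : ℝ → ℝ := fun x ↦ (h a - h x) / 2 + (x - a) * h' x / 2 - C * (x - a) ^ 2 / 4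
  have hid (x : ℝ) : HasDerivAt (fun y : ℝ ↦ y - a) 1 x := (hasDerivAt_id x).sub_const a
  have hP : ∀ x ∈ Icc a (a + 1), HasDerivAt P (Q x) x := by
    intro x hx
    have := ((((hid x).mul ((hh x hx).const_add (h a))).div_const 2).sub
      ((hH x hx).sub_const (H a))).sub ((((hid x).pow 3).const_mul C).div_const 12)
    refine this.congr_deriv ?_
    simp only [Q]; push_cast; ring
  have hQ : ∀ x ∈ Icc a (a + 1), HasDerivAt Q ((x - a) / 2 * (h'' x - C)) x := by
    intro x hx
    have := ((((hh x hx).const_sub (h a)).div_const 2).add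
      (((hid x).mul (hh' x hx)).div_const 2)).sub ((((hid x).pow 2).const_mul C).div_const 4)
    refine this.congr_deriv ?_
    push_cast; ring
  have hQ0 : AntitoneOn Q (Icc a (a + 1)) := by
    refine antitoneOn_of_hasDerivWithinAt_nonpos (convex_Icc _ _)
      (fun x hx ↦ (hQ x hx).continuousAt.continuousWithinAt)
      (fun x hx ↦ (hQ x (interior_subset hx)).hasDerivWithinAt) fun x hx ↦ ?_
    have hx := interior_subset hx
    exact mul_nonpos_of_nonneg_of_nonpos (by linarith [hx.1]) (by linarith [hC x hx])
  have hP0 : AntitoneOn P (Icc a (a + 1)) := by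
    refine antitoneOn_of_hasDerivWithinAt_nonpos (convex_Icc _ _)
      (fun x hx ↦ (hP x hx).continuousAt.continuousWithinAt)
      (fun x hx ↦ (hP x (interior_subset hx)).hasDerivWithinAt) fun x hx ↦ ?_
    have hx := interior_subset hx
    have := hQ0 ha hx hx.1
    simpa [Q] using this
  have := hP0 ha hb (by linarith)
  simp only [P, sub_self, add_sub_cancel_left] at this
  norm_num at this
  linarith

lemma rpow_second_deriv_bound {s a x : ℝ} (hs : 0 < s) (hs1 : s < 1) (ha : 1 ≤ a) (hx : a ≤ x) :
    s * (s + 1) * x ^ (-s - 2) - 2 * s / x ^ 3 ≤ 3 * s * (1 - s) * (1 / a - 1 / (a + 1)) := by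
  have hx0 : 0 < x := by linarith
  have ha0 : 0 < a := by linarith
  have hpow : x ^ (-s - 2) = x ^ (1 - s) / x ^ 3 := by
    rw [← Real.rpow_natCast, ← Real.rpow_sub hx0]; congr 1; push_cast; ring
  have hbern : x ^ (1 - s) ≤ 1 + (1 - s) * (x - 1) := by
    have := rpow_one_add_le_one_add_mul_self (s := x - 1) (by linarith)
      (p := 1 - s) (by linarith) (by linarith)
    simpa using this
  have hsplit : 1 / a - 1 / (a + 1) = 1 / (a * (a + 1)) := by field_simp; ring
  have hcube : a * (a + 1) * (2 * x - 3) ≤ 3 * x ^ 3 := by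
    have h1 : a * (a + 1) ≤ x * (x + 1) := by nlinarith
    have h2 : 0 ≤ a * (a + 1) := by positivity
    rcases le_total 0 (2 * x - 3) with h | h
    · have := mul_le_mul_of_nonneg_right h1 h
      nlinarith [pow_pos hx0 3, pow_pos hx0 2]
    · nlinarith [pow_pos hx0 3, mul_nonneg h2 (neg_nonneg.2 h)]
  calc s * (s + 1) * x ^ (-s - 2) - 2 * s / x ^ 3
      = s * ((s + 1) * x ^ (1 - s) - 2) / x ^ 3 := by rw [hpow]; ring
    _ ≤ s * ((1 - s) * (2 * x - 3)) / x ^ 3 := by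
        gcongr
        have : 0 ≤ (1 - s) ^ 2 * (x - 1) := by
          have : 0 ≤ x - 1 := by linarith
          positivity
        nlinarith
    _ = s * (1 - s) * ((2 * x - 3) / x ^ 3) := by ring
    _ ≤ s * (1 - s) * (3 * (1 / (a * (a + 1)))) := by
        have : 0 ≤ s * (1 - s) := mul_nonneg hs.le (by linarith)
        refine mul_le_mul_of_nonneg_left ?_ this
        rw [mul_one_div, div_le_div_iff₀ (by positivity) (by positivity)]
        linarith
    _ = _ := by rw [hsplit]; ring

lemma rpow_trapezoid_error_le {s a : ℝ} (hs : 0 < s) (hs1 : s < 1) (ha : 1 ≤ a) :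
    ((a ^ (-s) - s / a) + ((a + 1) ^ (-s) - s / (a + 1))) / 2 -
      (((a + 1) ^ (1 - s) / (1 - s) - s * Real.log (a + 1)) -
        (a ^ (1 - s) / (1 - s) - s * Real.log a)) ≤
      s * (1 - s) / 4 * (1 / a - 1 / (a + 1)) := by
  have h1s : 1 - s ≠ 0 := by linarith
  refine (trapezoid_error_le (H := fun x ↦ x ^ (1 - s) / (1 - s) - s * Real.log x)
    (h := fun x ↦ x ^ (-s) - s / x) (h' := fun x ↦ -s * x ^ (-s - 1) + s / x ^ 2)
    (h'' := fun x ↦ s * (s + 1) * x ^ (-s - 2) - 2 * s / x ^ 3) ?_ ?_ ?_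
    (fun x hx ↦ rpow_second_deriv_bound hs hs1 ha hx.1)).trans_eq (by ring)
  all_goals
    intro x hx
    have hx0 : 0 < x := by linarith [hx.1]
  · refine (((Real.hasDerivAt_rpow_const (Or.inl hx0.ne')).div_const _).sub
      ((Real.hasDerivAt_log hx0.ne').const_mul s)).congr_deriv ?_
    rw [show 1 - s - 1 = -s by ring]
    field_simp
  · refine ((Real.hasDerivAt_rpow_const (p := -s) (Or.inl hx0.ne')).sub
      ((hasDerivAt_inv hx0.ne').const_mul s)).congr_deriv ?_
    ring
  · refine (((Real.hasDerivAt_rpow_const (p := -s - 1) (Or.inl hx0.ne')).const_mul (-s)).add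
      (((hasDerivAt_pow 2 x).inv (by positivity)).const_mul s)).congr_deriv ?_
    rw [show -s - 1 - 1 = -s - 2 by ring]
    field_simp
    ring

lemma sum_rpow_sub_le {s : ℝ} (hs : 0 < s) (hs1 : s < 1) (N : ℕ) :
    ∑ n ∈ Finset.range N, (((n : ℝ) + 1) ^ (-s) - s / ((n : ℝ) + 1)) +
      (((N : ℝ) + 1) ^ (-s) - s / ((N : ℝ) + 1)) / 2 -
      (((N : ℝ) + 1) ^ (1 - s) / (1 - s) - s * Real.log ((N : ℝ) + 1)) + 1 / (1 - s) ≤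
      (1 - s) / 2 + s * (1 - s) / 4 * (1 - 1 / ((N : ℝ) + 1)) := by
  induction N with
  | zero => simp
  | succ N ih =>
    have := rpow_trapezoid_error_le hs hs1 (a := (N : ℝ) + 1) (by simp)
    rw [Finset.sum_range_succ]
    push_cast
    linarith

lemma norm_cpow_sub_le {s : ℂ} (hs : 0 < s.re) {a : ℝ} (ha : 0 < a) :
    ‖(1 - s) * (a : ℂ) ^ (-s) - (((a + 1 : ℝ) : ℂ) ^ (1 - s) - (a : ℂ) ^ (1 - s))‖ ≤
      ‖1 - s‖ * ‖s‖ * a ^ (-s.re - 1) := by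
  by_cases h1 : s = 1
  · simp [h1]
  by_cases h0 : s = 0
  · simp [h0] at hs
  have h1' : 1 - s ≠ 0 := sub_ne_zero.2 (Ne.symm h1)
  have hder (r : ℂ) (hr : r ≠ 0) {x : ℝ} (hx : a ≤ x) :
      HasDerivAt (fun y : ℝ ↦ (y : ℂ) ^ r) (r * (x : ℂ) ^ (r - 1)) x := by
    exact hasDerivAt_ofReal_cpow_const (by linarith) hr
  have hbound : ∀ x ∈ Icc a (a + 1), ‖(x : ℂ) ^ (-s) - (a : ℂ) ^ (-s)‖ ≤
      ‖s‖ * a ^ (-s.re - 1) := by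
    intro x hx
    have := norm_image_sub_le_of_norm_deriv_le_segment' (a := a) (b := a + 1)
      (f := fun y : ℝ ↦ (y : ℂ) ^ (-s)) (C := ‖s‖ * a ^ (-s.re - 1))
      (fun y hy ↦ (hder (-s) (neg_ne_zero.2 h0) hy.1).hasDerivWithinAt) ?_ x hx
    · refine this.trans ?_
      have h2 : 0 ≤ ‖s‖ * a ^ (-s.re - 1) := by positivity
      nlinarith [hx.2]
    · intro y hy
      have hy0 : 0 < y := ha.trans_le hy.1
      rw [norm_mul, norm_neg, Complex.norm_cpow_eq_rpow_re_of_pos hy0]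
      gcongr
      simpa using Real.rpow_le_rpow_of_nonpos ha hy.1 (by linarith)
  have := norm_image_sub_le_of_norm_deriv_le_segment' (a := a) (b := a + 1)
    (f := fun y : ℝ ↦ (y : ℂ) ^ (1 - s) - (1 - s) * (a : ℂ) ^ (-s) * y)
    (f' := fun y ↦ (1 - s) * ((y : ℂ) ^ (-s) - (a : ℂ) ^ (-s)))
    (C := ‖1 - s‖ * (‖s‖ * a ^ (-s.re - 1))) ?_ ?_ (a + 1) (by simp)
  · rw [← norm_neg]
    convert this using 1
    · congr 1; push_cast; ring
    · ring
  · intro y hy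
    refine ((hder (1 - s) h1' hy.1).sub
      ((Complex.ofRealCLM.hasDerivAt (x := y)).const_mul _)).hasDerivWithinAt.congr_deriv ?_
    rw [show 1 - s - 1 = -s by ring]
    simp; ring
  · intro y hy
    rw [norm_mul]
    gcongr
    exact hbound y ⟨hy.1, hy.2.le⟩

/-- The terms of a series for `1 - (s - 1) * ζ s` which converges for `0 < re s`. -/
noncomputable def zetaTerm (n : ℕ) (s : ℂ) : ℂ :=
  (1 - s) * ((n + 1 : ℝ) : ℂ) ^ (-s) -
    (((n + 1 + 1 : ℝ) : ℂ) ^ (1 - s) - ((n + 1 : ℝ) : ℂ) ^ (1 - s))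

lemma sum_zetaTerm (s : ℂ) (N : ℕ) :
    ∑ n ∈ Finset.range N, zetaTerm n s =
      (1 - s) * ∑ n ∈ Finset.range N, ((n + 1 : ℝ) : ℂ) ^ (-s) -
        ((N + 1 : ℝ) : ℂ) ^ (1 - s) + 1 := by
  induction N with
  | zero => simp
  | succ N ih =>
    rw [Finset.sum_range_succ, ih, Finset.sum_range_succ, zetaTerm]
    push_cast
    ring

lemma differentiable_zetaTerm (n : ℕ) : Differentiable ℂ (zetaTerm n) := by
  have h1 : ((n + 1 : ℝ) : ℂ) ≠ 0 := by exact_mod_cast n.succ_ne_zero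
  have h2 : ((n + 1 + 1 : ℝ) : ℂ) ≠ 0 := by exact_mod_cast (n + 1).succ_ne_zero
  intro s
  unfold zetaTerm
  exact (((differentiableAt_const _).sub differentiableAt_id).mul
    (differentiableAt_id.neg.const_cpow (.inl h1))).sub
    ((((differentiableAt_const _).sub differentiableAt_id).const_cpow (.inl h2)).sub
    (((differentiableAt_const _).sub differentiableAt_id).const_cpow (.inl h1)))

lemma norm_zetaTerm_le {s : ℂ} {σ M : ℝ} (hσ : 0 < σ) (hs : σ < s.re) (hM : ‖s‖ < M) (n : ℕ) :
    ‖zetaTerm n s‖ ≤ (1 + M) * M * (n + 1 : ℝ) ^ (-σ - 1) := by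
  refine (norm_cpow_sub_le (hσ.trans hs) (by positivity)).trans ?_
  have h1 : ‖1 - s‖ ≤ 1 + M := (norm_sub_le _ _).trans (by simpa using hM.le)
  have hM0 : 0 ≤ M := (norm_nonneg s).trans hM.le
  gcongr
  simp

lemma summable_zetaTerm_bound {σ : ℝ} (hσ : 0 < σ) (M : ℝ) :
    Summable fun n : ℕ ↦ (1 + M) * M * (n + 1 : ℝ) ^ (-σ - 1) := by
  refine Summable.mul_left _ ?_
  have := (summable_nat_add_iff 1).2 (Real.summable_nat_rpow (p := -σ - 1) |>.2 (by linarith))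
  simpa using this

lemma tsum_zetaTerm_of_one_lt {s : ℂ} (hs : 1 < s.re) :
    ∑' n, zetaTerm n s = 1 - riemannZeta₁ s := by
  have hs1 : s ≠ 1 := by rintro rfl; simp at hs
  have hsum : Summable fun n ↦ zetaTerm n s :=
    .of_norm_bounded (summable_zetaTerm_bound one_pos (‖s‖ + 1))
      fun n ↦ norm_zetaTerm_le one_pos hs (by simp) n
  refine tendsto_nhds_unique hsum.hasSum.tendsto_sum_nat ?_
  simp_rw [sum_zetaTerm]
  have hz : Tendsto (fun N ↦ ∑ n ∈ Finset.range N, ((n + 1 : ℝ) : ℂ) ^ (-s)) atTop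
      (𝓝 (riemannZeta s)) := by
    have h := (summable_nat_add_iff 1).2 (Complex.summable_one_div_nat_cpow.2 hs)
    have := h.hasSum.tendsto_sum_nat
    rw [zeta_eq_tsum_one_div_nat_add_one_cpow hs]
    simpa [Complex.cpow_neg] using this
  have hp : Tendsto (fun N : ℕ ↦ ((N + 1 : ℝ) : ℂ) ^ (1 - s)) atTop (𝓝 0) := by
    rw [tendsto_zero_iff_norm_tendsto_zero]
    have : Tendsto (fun N : ℕ ↦ ((N : ℝ) + 1) ^ (-(s.re - 1))) atTop (𝓝 0) :=
      (tendsto_rpow_neg_atTop (by linarith)).comp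
        (tendsto_atTop_add_const_right _ _ tendsto_natCast_atTop_atTop)
    refine this.congr fun N ↦ ?_
    rw [Complex.norm_cpow_eq_rpow_re_of_pos (by positivity)]
    simp
  convert ((hz.const_mul (1 - s)).sub hp).add_const 1 using 2
  rw [riemannZeta_eq_inv_sub_mul hs1]
  have := sub_ne_zero.2 hs1
  field_simp
  ring

lemma hasSum_zetaTerm {s : ℂ} (hs : 0 < s.re) :
    HasSum (fun n ↦ zetaTerm n s) (1 - riemannZeta₁ s) := by
  set σ : ℝ := min (s.re / 2) 1
  have hσ : 0 < σ := by positivity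
  set M : ℝ := ‖s‖ + 3
  let U : Set ℂ := {z | σ < z.re} ∩ Metric.ball 0 M
  have hU : IsOpen U := (isOpen_lt continuous_const Complex.continuous_re).inter Metric.isOpen_ball
  have hUc : Convex ℝ U := (convex_halfSpace_re_gt σ).inter (convex_ball 0 M)
  have hsU : s ∈ U := by
    refine ⟨?_, by simp [M]⟩
    have : σ ≤ s.re / 2 := min_le_left _ _
    simp only [mem_ofPred_eq]; linarith
  have h2U : (2 : ℂ) ∈ U := by
    refine ⟨?_, ?_⟩
    · have : σ ≤ 1 := min_le_right _ _
      simp only [mem_ofPred_eq, Complex.re_ofNat]; linarith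
    · simp only [M, mem_ball_zero_iff, Complex.norm_ofNat]; linarith [norm_nonneg s]
  have hbd (n : ℕ) (z : ℂ) (hz : z ∈ U) :
      ‖zetaTerm n z‖ ≤ (1 + M) * M * (n + 1 : ℝ) ^ (-σ - 1) :=
    norm_zetaTerm_le hσ hz.1 (by simpa using hz.2) n
  have hsummable := summable_zetaTerm_bound hσ M
  have hdiff := Complex.differentiableOn_tsum_of_summable_norm hsummable
    (fun n ↦ (differentiable_zetaTerm n).differentiableOn) hU hbd
  have hdiff' : DifferentiableOn ℂ (fun z ↦ 1 - riemannZeta₁ z) U := by fun_prop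
  have hev : (fun z ↦ ∑' n, zetaTerm n z) =ᶠ[𝓝 2] fun z ↦ 1 - riemannZeta₁ z := by
    filter_upwards [(isOpen_lt continuous_const Complex.continuous_re).mem_nhds
      (show (2 : ℂ) ∈ {z : ℂ | 1 < z.re} by simp)] with z hz
    exact tsum_zetaTerm_of_one_lt hz
  have heq := (hdiff.analyticOnNhd hU).eqOn_of_preconnected_of_eventuallyEq
    (hdiff'.analyticOnNhd hU) hUc.isPreconnected h2U hev hsU
  have := (Summable.of_norm_bounded hsummable fun n ↦ hbd n s hsU).hasSum
  exact (show _ = 1 - riemannZeta₁ s from heq) ▸ this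

/-- `ζ s` on `(0, 1)` as a limit of regularized partial sums. -/
lemma tendsto_sum_rpow_sub {s : ℝ} (hs : 0 < s) (hs1 : s < 1) :
    Tendsto (fun N : ℕ ↦ ∑ n ∈ Finset.range N, ((n : ℝ) + 1) ^ (-s) -
      ((N : ℝ) + 1) ^ (1 - s) / (1 - s)) atTop (𝓝 (riemannZeta s).re) := by
  have h := (hasSum_zetaTerm (s := s) (by simpa using hs)).tendsto_sum_nat
  have h1 : (1 : ℝ) - s ≠ 0 := by linarith
  have h1' : (s : ℂ) - 1 ≠ 0 := by exact_mod_cast (by linarith : s - 1 ≠ 0)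
  have h2 := (Complex.continuous_re.tendsto _).comp ((h.sub_const 1).div_const (1 - s : ℂ))
  have h1'' : (1 : ℂ) - s ≠ 0 := by exact_mod_cast h1
  convert h2 using 2 with N
  · rw [Function.comp_apply, sum_zetaTerm]
    have : ((1 - (s : ℂ)) * ∑ n ∈ Finset.range N, ((n + 1 : ℝ) : ℂ) ^ (-(s : ℂ)) -
        ((N + 1 : ℝ) : ℂ) ^ (1 - (s : ℂ)) + 1 - 1) / (1 - (s : ℂ)) =
        ((∑ n ∈ Finset.range N, ((n : ℝ) + 1) ^ (-s) -
          ((N : ℝ) + 1) ^ (1 - s) / (1 - s) : ℝ) : ℂ) := by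
      push_cast [Complex.ofReal_cpow (show (0 : ℝ) ≤ (N : ℝ) + 1 by positivity)]
      have (n : ℕ) : ((((n : ℝ) + 1) ^ (-s) : ℝ) : ℂ) = ((n : ℂ) + 1) ^ (-(s : ℂ)) := by
        rw [Complex.ofReal_cpow (by positivity)]; push_cast; rfl
      simp_rw [this]
      field_simp
      ring
    rw [this, Complex.ofReal_re]
  · rw [riemannZeta_eq_inv_sub_mul (sub_ne_zero.1 h1')]
    congr 1
    field_simp
    ring

lemma riemannZeta_re_le {s : ℝ} (hs : 0 < s) (hs1 : s < 1) :
    (riemannZeta s).re + 1 / (1 - s) ≤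
      s * Real.eulerMascheroniConstant + (1 - s) / 2 + s * (1 - s) / 4 := by
  have h := (tendsto_sum_rpow_sub hs hs1).sub
    (Real.tendsto_harmonic_sub_log_add_one.const_mul s)
  have hle := le_of_tendsto' h (b := (1 - s) / 2 + s * (1 - s) / 4 - 1 / (1 - s)) fun N ↦ by
    have h1 := sum_rpow_sub_le hs hs1 N
    have h2 : s / ((N : ℝ) + 1) ≤ ((N : ℝ) + 1) ^ (-s) := by
      have h3 : ((N : ℝ) + 1) ^ (-1 : ℝ) ≤ ((N : ℝ) + 1) ^ (-s) :=
        Real.rpow_le_rpow_of_exponent_le (by simp) (by linarith)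
      refine le_trans ?_ h3
      rw [Real.rpow_neg_one, div_eq_mul_inv]
      exact mul_le_of_le_one_left (by positivity) hs1.le
    have h4 : 0 ≤ s * (1 - s) / 4 * (1 / ((N : ℝ) + 1)) := by
      have : 0 ≤ 1 - s := by linarith
      positivity
    have h5 : s * (harmonic N : ℝ) = ∑ n ∈ Finset.range N, s / ((n : ℝ) + 1) := by
      simp [harmonic, Finset.mul_sum, div_eq_mul_inv]
    rw [Finset.sum_sub_distrib] at h1
    rw [mul_sub, h5]
    linarith
  linarith

lemma digammaReal_add_one {x : ℝ} (hx : 0 < x) :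
    digammaReal (x + 1) = digammaReal x + 1 / x := by
  have hG {y : ℝ} (hy : 0 < y) : DifferentiableAt ℝ Real.Gamma y :=
    Real.differentiableAt_Gamma fun m ↦ by
      have : (0 : ℝ) ≤ m := m.cast_nonneg
      linarith
  have h : deriv Real.Gamma (x + 1) = Real.Gamma x + x * deriv Real.Gamma x := by
    rw [← deriv_comp_add_const]
    have : (fun y ↦ Real.Gamma (y + 1)) =ᶠ[𝓝 x] fun y ↦ y * Real.Gamma y := by
      filter_upwards [eventually_ne_nhds hx.ne'] with y hy
      exact Real.Gamma_add_one hy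
    rw [this.deriv_eq]
    have := ((hasDerivAt_id' x).fun_mul (hG hx).hasDerivAt).deriv
    simpa [add_comm] using this
  have := (Real.Gamma_pos_of_pos hx).ne'
  rw [digammaReal, digammaReal, h, Real.Gamma_add_one hx.ne']
  field_simp
  ring

lemma monotoneOn_digammaReal : MonotoneOn digammaReal (Ioi 0) := by
  have hG {y : ℝ} (hy : 0 < y) : DifferentiableAt ℝ Real.Gamma y :=
    Real.differentiableAt_Gamma fun m ↦ by
      have : (0 : ℝ) ≤ m := m.cast_nonneg
      linarith
  have hd {y : ℝ} (hy : 0 < y) : HasDerivAt (Real.log ∘ Real.Gamma) (digammaReal y) y :=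
    (hG hy).hasDerivAt.log (Real.Gamma_pos_of_pos hy).ne'
  have := Real.convexOn_log_Gamma.monotoneOn_deriv fun x hx ↦ (hd hx).differentiableAt
  exact this.congr fun x hx ↦ (hd hx).deriv

lemma digammaReal_add_nat {x : ℝ} (hx : 0 < x) (N : ℕ) :
    digammaReal (x + N) = digammaReal x + ∑ n ∈ Finset.range N, 1 / (x + n) := by
  induction N with
  | zero => simp
  | succ N ih =>
    rw [Finset.sum_range_succ, ← add_assoc, ← ih, ← digammaReal_add_one (by positivity)]
    push_cast
    ring_nf

lemma digammaReal_one : digammaReal 1 = -Real.eulerMascheroniConstant := by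
  rw [digammaReal, Real.hasDerivAt_Gamma_one.deriv, Real.Gamma_one, div_one]

lemma sum_one_div_sub_ge {s : ℝ} (hs : 0 < s) (hs1 : s < 1) (N : ℕ) :
    (1 - s) * (s * (1 / (2 * (2 - s)) + 1 / (6 * (3 - s))) - 1 / ((N : ℝ) + 3)) ≤
      ∑ n ∈ Finset.range (N + 2), (1 / (1 + n : ℝ) - 1 / (2 - s + n)) - (1 - s) := by
  induction N with
  | zero =>
    rw [Finset.sum_range_succ, Finset.sum_range_one]
    have h1 : 2 - s ≠ 0 := by linarith
    have h2 : 3 - s ≠ 0 := by linarith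
    have h3 : 2 - s + 1 = 3 - s := by ring
    refine le_of_eq ?_
    push_cast
    simp only [h3, add_zero]
    field_simp
    ring
  | succ N ih =>
    rw [Finset.sum_range_succ]
    have hN : (0 : ℝ) ≤ N := N.cast_nonneg
    have key : (1 - s) * (1 / ((N : ℝ) + 3) - 1 / ((N : ℝ) + 4)) ≤
        1 / ((N : ℝ) + 3) - 1 / ((N : ℝ) + 4 - s) := by
      have h4 : 0 < (N : ℝ) + 4 - s := by linarith
      rw [show 1 / ((N : ℝ) + 3) - 1 / ((N : ℝ) + 4) = 1 / (((N : ℝ) + 3) * ((N : ℝ) + 4)) by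
          field_simp; ring,
        show 1 / ((N : ℝ) + 3) - 1 / ((N : ℝ) + 4 - s) =
          (1 - s) * (1 / (((N : ℝ) + 3) * ((N : ℝ) + 4 - s))) by
          field_simp; ring]
      have : 0 ≤ 1 - s := by linarith
      gcongr
      linarith
    push_cast
    rw [show 1 + ((N : ℝ) + 2) = N + 3 by ring, show 2 - s + ((N : ℝ) + 2) = N + 4 - s by ring,
      show (N : ℝ) + 1 + 3 = N + 4 by ring]
    linarith

lemma digammaReal_two_sub_ge {s : ℝ} (hs : 0 < s) (hs1 : s < 1) :
    (1 - s) * (s * (1 / (2 * (2 - s)) + 1 / (6 * (3 - s)))) ≤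
      digammaReal (2 - s) + Real.eulerMascheroniConstant - (1 - s) := by
  have hlim : Tendsto (fun N : ℕ ↦ (1 - s) * (s * (1 / (2 * (2 - s)) + 1 / (6 * (3 - s))) -
      1 / ((N : ℝ) + 3))) atTop
      (𝓝 ((1 - s) * (s * (1 / (2 * (2 - s)) + 1 / (6 * (3 - s))) - 0))) := by
    refine Tendsto.const_mul _ (tendsto_const_nhds.sub ?_)
    simp_rw [one_div]
    exact tendsto_inv_atTop_zero.comp
      (tendsto_atTop_add_const_right _ _ tendsto_natCast_atTop_atTop)
  rw [sub_zero] at hlim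
  refine le_of_tendsto' hlim fun N ↦ (sum_one_div_sub_ge hs hs1 N).trans ?_
  have h1 := digammaReal_add_nat one_pos (N + 2)
  have h2 := digammaReal_add_nat (x := 2 - s) (by linarith) (N + 2)
  have h3 : digammaReal (1 + (N + 2 : ℕ)) ≤ digammaReal (2 - s + (N + 2 : ℕ)) := by
    have : (0 : ℝ) ≤ (N + 2 : ℕ) := Nat.cast_nonneg _
    exact monotoneOn_digammaReal (by simp only [mem_Ioi]; linarith)
      (by simp only [mem_Ioi]; linarith) (by linarith)
  rw [digammaReal_one] at h1
  rw [Finset.sum_sub_distrib]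
  linarith

theorem stmt_17 (s : ℝ) (hs : 0 < s) (hs1 : s < 1) :
    (riemannZeta s).re - digammaReal (1 - s) <
      (Real.eulerMascheroniConstant - 1 / 2) + (Real.eulerMascheroniConstant + 1 / 2) * s := by
  have h1 := riemannZeta_re_le hs hs1
  have h2 := digammaReal_two_sub_ge hs hs1
  have h3 := digammaReal_add_one (x := 1 - s) (by linarith)
  rw [show 1 - s + 1 = 2 - s by ring] at h3
  have h4 : 1 / 4 < 1 / (2 * (2 - s)) + 1 / (6 * (3 - s)) := by
    have h5 : 1 / 4 ≤ 1 / (2 * (2 - s)) := one_div_le_one_div_of_le (by linarith) (by linarith)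
    have h6 : 0 < 1 / (6 * (3 - s)) := one_div_pos.2 (by linarith)
    linarith
  have h7 : 0 < s * (1 - s) := mul_pos hs (by linarith)
  have h8 := mul_lt_mul_of_pos_left h4 h7
  linarith
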